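/- Let J ≥ 2 be an integer and let μ, ν, ν′ be Borel probability measures on ℝ such that the characteristic function of μ is nowhere zero. Let F and G denote the cumulative distribution functions of the convolutions μ ∗ ν and μ ∗ ν′, respectively. If J·F(t)^{J−1} − (J−1)·F(t)^{J} = J·G(t)^{J−1} − (J−1)·G(t)^{J} for every t ∈ ℝ, then ν = ν′. -/

import Mathlib

open MeasureTheory ProbabilityTheory

lemma second_order_poly_strictMono (n : ℕ) :
    StrictMonoOn (fun x : ℝ => ((n : ℝ) + 2) * x ^ (n + 1) - ((n : ℝ) + 1) * x ^ (n + 2))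
      (Set.Icc 0 1) := by
  apply strictMonoOn_of_deriv_pos (convex_Icc 0 1) (by fun_prop)
  intro x hx
  rw [interior_Icc] at hx
  have hd : HasDerivAt
      (fun x : ℝ => ((n : ℝ) + 2) * x ^ (n + 1) - ((n : ℝ) + 1) * x ^ (n + 2))
      (((n : ℝ) + 2) * (((n + 1 : ℕ) : ℝ) * x ^ n)
        - ((n : ℝ) + 1) * (((n + 2 : ℕ) : ℝ) * x ^ (n + 1))) x :=
    ((hasDerivAt_pow (n + 1) x).const_mul _).sub ((hasDerivAt_pow (n + 2) x).const_mul _)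
  rw [hd.deriv]
  have h1 : 0 < 1 - x := by linarith [hx.2]
  have h0 : 0 < x := hx.1
  have : 0 < ((n : ℝ) + 2) * ((n : ℝ) + 1) * x ^ n * (1 - x) := by positivity
  push_cast
  rw [pow_succ]
  linarith

/-- Identification of the cost distribution (Lemma 2): if the distributions of the
second-largest of `J` i.i.d. draws from `μ ∗ ν` and from `μ ∗ ν'` agree, where `μ` has
nowhere-vanishing characteristic function, then `ν = ν'`. -/
theorem second_order_statistic_deconvolution_unique
    (J : ℕ) (hJ : 2 ≤ J)
    (μ ν ν' : Measure ℝ) [IsProbabilityMeasure μ] [IsProbabilityMeasure ν]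
    [IsProbabilityMeasure ν']
    (hchar : ∀ t : ℝ, (∫ x, Complex.exp (t * x * Complex.I) ∂μ) ≠ 0)
    (h : ∀ t : ℝ,
      (J : ℝ) * cdf (Measure.conv μ ν) t ^ (J - 1)
          - ((J : ℝ) - 1) * cdf (Measure.conv μ ν) t ^ J
        = (J : ℝ) * cdf (Measure.conv μ ν') t ^ (J - 1)
          - ((J : ℝ) - 1) * cdf (Measure.conv μ ν') t ^ J) :
    ν = ν' := by
  have hconv : Measure.conv μ ν = Measure.conv μ ν' := by
    apply Measure.eq_of_cdf
    ext t
    obtain ⟨n, rfl⟩ := Nat.exists_eq_add_of_le' hJ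
    apply (second_order_poly_strictMono n).injOn ⟨cdf_nonneg _ t, cdf_le_one _ t⟩
      ⟨cdf_nonneg _ t, cdf_le_one _ t⟩
    have ht := h t
    have e : n + 2 - 1 = n + 1 := rfl
    have e2 : ((n : ℝ) + 2) - 1 = n + 1 := by ring
    rw [e] at ht
    push_cast at ht
    rw [e2] at ht
    exact ht
  apply Measure.ext_of_charFun
  ext t
  have hc := congrArg (fun m => charFun m t) hconv
  simp only [charFun_conv] at hc
  refine mul_left_cancel₀ ?_ hc
  rw [charFun_apply_real]
  exact hchar t
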